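/- arXiv:1802.00568 — 4 statements merged into one kernel-verified Lean document; each statement's English description precedes it below -/
import Mathlib

section
/- Let X₀ ∈ ℝ^{n×n} be symmetric, let λ > 0 and t > 0 satisfy λt > 1, and let ℓ be a natural number with ℓ < n. Assume that for every subset S ⊆ {1,…,n} with |S| ≥ n − ℓ the principal submatrix (X₀)_{S,S} satisfies λ_max((X₀)_{S,S}) ≥ t. If m ∈ (−1,1)ⁿ is such that the matrix −λX₀ + diag((1−mᵢ²)⁻¹ : i = 1,…,n) is positive semidefinite (this matrix is the Hessian of the naive mean-field free energy F(m) = −(λ/2)⟨m, X₀ m⟩ − Σᵢ h(mᵢ), so the hypothesis holds at any local minimum of F), then at least ℓ+1 coordinates satisfy mᵢ² ≥ 1 − 1/(λt); in particular ‖m‖₂² ≥ (ℓ+1)(1 − 1/(λt)). -/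
open Finset

/-- The largest eigenvalue of a symmetric real matrix, expressed as the supremum of its
Rayleigh quotient over the unit sphere. -/
noncomputable def lamMax {m : Type*} [Fintype m] (A : Matrix m m ℝ) : ℝ :=
  sSup {r : ℝ | ∃ x : m → ℝ, (∑ i, x i ^ 2) = 1 ∧ r = ∑ i, ∑ j, x i * A i j * x j}

/-- The binary entropy function. -/
noncomputable def binEnt (x : ℝ) : ℝ :=
  -((1 + x) / 2) * Real.log ((1 + x) / 2) - ((1 - x) / 2) * Real.log ((1 - x) / 2)

open scoped Matrix in
/-- If `-lam • A + diagonal d` is positive semidefinite and the entries of `d` are at most `D`,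
then the largest eigenvalue of `A` is at most `D / lam`. -/
theorem lamMax_le_of_posSemidef {ι : Type*} [Fintype ι] [DecidableEq ι] {A : Matrix ι ι ℝ}
    {d : ι → ℝ} {lam D : ℝ} (hlam : 0 < lam) (hD : 0 ≤ D) (hd : ∀ i, d i ≤ D)
    (h : ((-lam) • A + Matrix.diagonal d).PosSemidef) : lamMax A ≤ D / lam := by
  refine Real.sSup_le ?_ (by positivity)
  rintro r ⟨x, hx, rfl⟩
  have h0 := h.dotProduct_mulVec_nonneg x
  have key : star x ⬝ᵥ (((-lam) • A + Matrix.diagonal d) *ᵥ x)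
      = -lam * ∑ i, ∑ j, x i * A i j * x j + ∑ i, d i * x i ^ 2 := by
    rw [Matrix.add_mulVec, dotProduct_add, Matrix.smul_mulVec, dotProduct_smul, smul_eq_mul]
    congr 1
    · simp only [dotProduct, Matrix.mulVec, Finset.mul_sum, star_trivial, mul_assoc]
    · simp only [dotProduct, Matrix.mulVec_diagonal, star_trivial]
      exact Finset.sum_congr rfl fun i _ => by ring
  have hsum : ∑ i, d i * x i ^ 2 ≤ D := by
    calc ∑ i, d i * x i ^ 2 ≤ ∑ i, D * x i ^ 2 :=
          Finset.sum_le_sum fun i _ => mul_le_mul_of_nonneg_right (hd i) (sq_nonneg _)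
      _ = D := by rw [← Finset.mul_sum, hx, mul_one]
  rw [key] at h0
  rw [le_div_iff₀ hlam]
  linarith

/-- If every principal submatrix of `X₀` of size at least `n - ℓ` has largest eigenvalue at
least `t`, with `λ t > 1`, then any `m ∈ (-1,1)ⁿ` at which the Hessian
`-λ X₀ + diag((1-mᵢ²)⁻¹)` of the naive mean-field free energy is positive semidefinite has at
least `ℓ+1` coordinates with `mᵢ² ≥ 1 - 1/(λt)`; in particular `‖m‖₂² ≥ (ℓ+1)(1 - 1/(λt))`. -/
theorem local_min_many_large_coordinates
    {n : ℕ} (X₀ : Matrix (Fin n) (Fin n) ℝ) (hX₀ : X₀.IsSymm)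
    (lam t : ℝ) (hlam : 0 < lam) (ht : 0 < t) (hlamt : 1 < lam * t)
    (ℓ : ℕ) (hℓ : ℓ < n)
    (hsub : ∀ S : Finset (Fin n), n - ℓ ≤ S.card →
      t ≤ lamMax (X₀.submatrix (fun i : {i // i ∈ S} => (i : Fin n))
            (fun i : {i // i ∈ S} => (i : Fin n))))
    (m : Fin n → ℝ) (hm : ∀ i, m i ∈ Set.Ioo (-1 : ℝ) 1)
    (hpsd : ((-lam) • X₀ + Matrix.diagonal (fun i => (1 - m i ^ 2)⁻¹)).PosSemidef) :
    ℓ + 1 ≤ (Finset.univ.filter (fun i => 1 - 1 / (lam * t) ≤ m i ^ 2)).card ∧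
    ((ℓ : ℝ) + 1) * (1 - 1 / (lam * t)) ≤ ∑ i, m i ^ 2 := by
  have hpos : 0 < lam * t := mul_pos hlam ht
  have hc : 0 ≤ 1 - 1 / (lam * t) := by
    rw [sub_nonneg, div_le_one hpos]
    exact hlamt.le
  have hcard : ℓ + 1 ≤ (Finset.univ.filter (fun i => 1 - 1 / (lam * t) ≤ m i ^ 2)).card := by
    by_contra! hlt
    set S := Finset.univ.filter (fun i => ¬ 1 - 1 / (lam * t) ≤ m i ^ 2) with hS
    have hadd := Finset.card_filter_add_card_filter_not (s := (Finset.univ : Finset (Fin n)))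
      (fun i => 1 - 1 / (lam * t) ≤ m i ^ 2)
    rw [Finset.card_univ, Fintype.card_fin, ← hS] at hadd
    have hne : S.Nonempty := Finset.card_pos.mp (by omega)
    obtain ⟨k, hkS, hk⟩ := S.exists_max_image (fun i => (1 - m i ^ 2)⁻¹) hne
    have hk0 : 0 < 1 - m k ^ 2 := by
      have := hm k
      nlinarith [this.1, this.2]
    have hklt : (1 - m k ^ 2)⁻¹ < lam * t := by
      have hk1 : m k ^ 2 < 1 - 1 / (lam * t) := not_le.mp (Finset.mem_filter.mp hkS).2
      rw [inv_lt_comm₀ hk0 hpos, ← one_div]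
      linarith
    have hsubm := hpsd.submatrix (fun i : {i // i ∈ S} => (i : Fin n))
    rw [Matrix.submatrix_add, Matrix.submatrix_smul, Pi.add_apply, Pi.add_apply,
      Pi.smul_apply, Pi.smul_apply,
      Matrix.submatrix_diagonal _ _ Subtype.val_injective] at hsubm
    have hle := lamMax_le_of_posSemidef hlam (inv_pos.mpr hk0).le
      (fun i : {i // i ∈ S} => hk i i.2) hsubm
    have ht_le := (hsub S (by omega)).trans hle
    rw [le_div_iff₀ hlam] at ht_le
    linarith
  refine ⟨hcard, ?_⟩
  calc ((ℓ : ℝ) + 1) * (1 - 1 / (lam * t))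
      ≤ (Finset.univ.filter (fun i => 1 - 1 / (lam * t) ≤ m i ^ 2)).card
          * (1 - 1 / (lam * t)) :=
        mul_le_mul_of_nonneg_right (by exact_mod_cast hcard) hc
    _ ≤ ∑ i ∈ Finset.univ.filter (fun i => 1 - 1 / (lam * t) ≤ m i ^ 2), m i ^ 2 := by
        rw [← nsmul_eq_mul]
        exact Finset.card_nsmul_le_sum _ _ _ fun i hi => (Finset.mem_filter.mp hi).2
    _ ≤ ∑ i, m i ^ 2 :=
        Finset.sum_le_sum_of_subset_of_nonneg (Finset.filter_subset _ _)
          fun i _ _ => sq_nonneg _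
end

section
/- Let β > 0, let k ≥ 2, and let μ be a probability measure on ℝ^k supported on the probability simplex P₁(k) and invariant under all coordinate permutations. Define E(q) = (∫ w₁² exp(−q‖w‖₂²/2) dμ(w)) / (∫ exp(−q‖w‖₂²/2) dμ(w)) and the tilted second-moment matrix G̃(ỹ; Q̃) = β · (∫ w wᵀ exp(⟨ỹ,w⟩ − ⟨w, Q̃ w⟩/2) dμ(w)) / (∫ exp(⟨ỹ,w⟩ − ⟨w, Q̃ w⟩/2) dμ(w)). Then for every y ∈ ℝ and all q̃₁, q̃₂ ∈ ℝ, G̃(y·1_k; q̃₁ I_k + q̃₂ J_k) = β · ((k² E(q̃₁) − 1)/(k(k−1))) · I_k − β · ((k E(q̃₁) − 1)/(k(k−1))) · J_k. -/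
open MeasureTheory

/-- A measure on `ℝ^k` is supported on the probability simplex `P₁(k)`. -/
def SimplexSupported {k : ℕ} (μ : Measure (Fin k → ℝ)) : Prop :=
  ∀ᵐ w ∂μ, (∀ i, 0 ≤ w i) ∧ (∑ i, w i) = 1

/-- A measure on `ℝ^k` is invariant under all coordinate permutations (exchangeable). -/
def Exchangeable {k : ℕ} (μ : Measure (Fin k → ℝ)) : Prop :=
  ∀ e : Equiv.Perm (Fin k), μ.map (fun w => w ∘ e) = μ

/-- `E(q) = (∫ w₁² e^{-q‖w‖²/2} dμ) / (∫ e^{-q‖w‖²/2} dμ)`, the tilted second moment of the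
first coordinate. -/
noncomputable def Eq1 {k : ℕ} (hk : 2 ≤ k) (μ : Measure (Fin k → ℝ)) (q : ℝ) : ℝ :=
  (∫ w, Real.exp (-q * (∑ i, w i ^ 2) / 2) * w (⟨0, by omega⟩ : Fin k) ^ 2 ∂μ) /
    (∫ w, Real.exp (-q * (∑ i, w i ^ 2) / 2) ∂μ)

/-- The tilted posterior second-moment matrix for a prior `μ`,
`G̃(ỹ; Q̃) = β (∫ w wᵀ e^{⟨ỹ,w⟩-⟨w,Q̃w⟩/2} dμ) / (∫ e^{⟨ỹ,w⟩-⟨w,Q̃w⟩/2} dμ)`. -/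
noncomputable def tiltedSecondMomentOf {k : ℕ} (μ : Measure (Fin k → ℝ)) (β : ℝ)
    (Q : Matrix (Fin k) (Fin k) ℝ) (y : Fin k → ℝ) : Matrix (Fin k) (Fin k) ℝ :=
  Matrix.of fun i j =>
    β * (∫ w, Real.exp ((∑ l, y l * w l) - (∑ l, ∑ l', w l * Q l l' * w l') / 2) *
          (w i * w j) ∂μ) /
      (∫ w, Real.exp ((∑ l, y l * w l) - (∑ l, ∑ l', w l * Q l l' * w l') / 2) ∂μ)

theorem SimplexSupported.integrable_of_continuous {k : ℕ} {μ : Measure (Fin k → ℝ)}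
    [IsFiniteMeasure μ] (hμ : SimplexSupported μ) {g : (Fin k → ℝ) → ℝ} (hg : Continuous g) :
    Integrable g μ := by
  obtain ⟨C, hC⟩ := (isCompact_stdSimplex ℝ (Fin k)).exists_bound_of_continuousOn hg.continuousOn
  exact Integrable.of_bound hg.aestronglyMeasurable C (hμ.mono fun w hw => hC w hw)

theorem Exchangeable.integral_comp_perm {k : ℕ} {μ : Measure (Fin k → ℝ)} (hμ : Exchangeable μ)
    {g : (Fin k → ℝ) → ℝ} (hg : Continuous g) (e : Equiv.Perm (Fin k)) :
    ∫ w, g (w ∘ e) ∂μ = ∫ w, g w ∂μ := by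
  have he : Measurable fun w : Fin k → ℝ => w ∘ e :=
    measurable_pi_lambda _ fun i => measurable_pi_apply (e i)
  have h := integral_map he.aemeasurable (hg.aestronglyMeasurable (μ := μ.map fun w => w ∘ e))
  rw [← h, hμ e]

/-- On the simplex, the symmetric tilt is the isotropic Gaussian tilt up to a constant. -/
theorem symmetric_exponent_eq {k : ℕ} (y q₁ q₂ : ℝ) {w : Fin k → ℝ} (hw : ∑ i, w i = 1) :
    (∑ l, y * w l) - (∑ l, ∑ l', w l *
        (q₁ • (1 : Matrix (Fin k) (Fin k) ℝ) + q₂ • Matrix.of (fun _ _ => (1 : ℝ)) :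
          Matrix (Fin k) (Fin k) ℝ) l l' *
          w l') / 2 =
      (y - q₂ / 2) + -q₁ * (∑ i, w i ^ 2) / 2 := by
  have h : ∀ l, ∑ l', w l *
      (q₁ • (1 : Matrix (Fin k) (Fin k) ℝ) + q₂ • Matrix.of (fun _ _ => (1 : ℝ)) :
          Matrix (Fin k) (Fin k) ℝ) l l' * w l' =
        q₁ * w l ^ 2 + q₂ * w l := by
    intro l
    simp only [Matrix.add_apply, Matrix.smul_apply, Matrix.one_apply, Matrix.of_apply, smul_eq_mul,
      mul_add, add_mul, Finset.sum_add_distrib, mul_ite, ite_mul, mul_one, mul_zero, zero_mul,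
      Finset.sum_ite_eq, Finset.mem_univ, if_true]
    rw [← Finset.mul_sum, hw]
    ring
  simp only [h, Finset.sum_add_distrib, ← Finset.mul_sum, hw]
  ring

section ExchangeableMoments

variable {k : ℕ} {μ : Measure (Fin k → ℝ)} {f : (Fin k → ℝ) → ℝ}

theorem Exchangeable.integral_mul_coord_mul_coord_perm (hμ : Exchangeable μ) (hf : Continuous f)
    (hperm : ∀ (e : Equiv.Perm (Fin k)) w, f (w ∘ e) = f w) (e : Equiv.Perm (Fin k))
    (i j : Fin k) :
    ∫ w, f w * (w (e i) * w (e j)) ∂μ = ∫ w, f w * (w i * w j) ∂μ := by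
  have h := hμ.integral_comp_perm (g := fun w => f w * (w i * w j)) (by fun_prop) e
  simpa only [hperm, Function.comp_apply] using h

theorem Exchangeable.integral_mul_coord_perm (hμ : Exchangeable μ) (hf : Continuous f)
    (hperm : ∀ (e : Equiv.Perm (Fin k)) w, f (w ∘ e) = f w) (e : Equiv.Perm (Fin k))
    (i : Fin k) :
    ∫ w, f w * w (e i) ∂μ = ∫ w, f w * w i ∂μ := by
  have h := hμ.integral_comp_perm (g := fun w => f w * w i) (by fun_prop) e
  simpa only [hperm, Function.comp_apply] using h

variable [IsFiniteMeasure μ]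

theorem SimplexSupported.sum_integral_mul_coord (hμ : SimplexSupported μ) (hf : Continuous f) :
    ∑ j, ∫ w, f w * w j ∂μ = ∫ w, f w ∂μ := by
  rw [← integral_finsetSum _ fun j _ => hμ.integrable_of_continuous (by fun_prop)]
  refine integral_congr_ae (hμ.mono fun w hw => ?_)
  simp only [← Finset.mul_sum, hw.2, mul_one]

theorem card_mul_integral_mul_coord (hsupp : SimplexSupported μ) (hexch : Exchangeable μ)
    (hf : Continuous f) (hperm : ∀ (e : Equiv.Perm (Fin k)) w, f (w ∘ e) = f w) (i : Fin k) :
    k * ∫ w, f w * w i ∂μ = ∫ w, f w ∂μ := by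
  have h : ∀ j, ∫ w, f w * w j ∂μ = ∫ w, f w * w i ∂μ := fun j => by
    simpa using hexch.integral_mul_coord_perm hf hperm (Equiv.swap i j) i
  simpa [h] using hsupp.sum_integral_mul_coord hf

theorem integral_mul_coord_sq_add (hsupp : SimplexSupported μ) (hexch : Exchangeable μ)
    (hf : Continuous f) (hperm : ∀ (e : Equiv.Perm (Fin k)) w, f (w ∘ e) = f w)
    {i j : Fin k} (hij : i ≠ j) :
    ∫ w, f w * (w i * w i) ∂μ + (k - 1) * ∫ w, f w * (w i * w j) ∂μ = ∫ w, f w * w i ∂μ := by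
  have hsum := hsupp.sum_integral_mul_coord (f := fun w => f w * w i) (by fun_prop)
  have h : ∀ l ∈ Finset.univ.erase i,
      ∫ w, f w * (w i * w l) ∂μ = ∫ w, f w * (w i * w j) ∂μ := by
    intro l hl
    have h := hexch.integral_mul_coord_mul_coord_perm hf hperm (Equiv.swap j l) i j
    rwa [Equiv.swap_apply_left,
      Equiv.swap_apply_of_ne_of_ne hij (Finset.ne_of_mem_erase hl).symm] at h
  simp only [mul_assoc] at hsum
  rw [← Finset.add_sum_erase _ _ (Finset.mem_univ i), Finset.sum_congr rfl h, Finset.sum_const,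
    Finset.card_erase_of_mem (Finset.mem_univ i), Finset.card_univ, Fintype.card_fin,
    nsmul_eq_mul, Nat.cast_sub (Fin.pos i), Nat.cast_one] at hsum
  exact hsum

end ExchangeableMoments

/-- For an exchangeable prior supported on the simplex, at a symmetric tilt
`ỹ = y 1_k`, `Q̃ = q̃₁ I_k + q̃₂ J_k`, the tilted second moment matrix equals
`β ((k²E(q̃₁)-1)/(k(k-1))) I_k - β ((kE(q̃₁)-1)/(k(k-1))) J_k`. -/
theorem tiltedSecondMoment_symmetric_eq
    (k : ℕ) (hk : 2 ≤ k) (β : ℝ) (hβ : 0 < β)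
    (μ : Measure (Fin k → ℝ)) [IsProbabilityMeasure μ]
    (hsupp : SimplexSupported μ) (hexch : Exchangeable μ) :
    ∀ (y q₁ q₂ : ℝ),
      tiltedSecondMomentOf μ β
          (q₁ • (1 : Matrix (Fin k) (Fin k) ℝ) + q₂ • Matrix.of (fun _ _ => (1 : ℝ)))
          (fun _ => y)
        = (β * ((k ^ 2 * Eq1 hk μ q₁ - 1) / (k * (k - 1)))) •
            (1 : Matrix (Fin k) (Fin k) ℝ) -
          (β * ((k * Eq1 hk μ q₁ - 1) / (k * (k - 1)))) •
            Matrix.of (fun _ _ => (1 : ℝ)) := by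
  intro y q₁ q₂
  have hk2 : (2 : ℝ) ≤ k := by exact_mod_cast hk
  have hk0 : (k : ℝ) ≠ 0 := by positivity
  have hk1 : (k : ℝ) - 1 ≠ 0 := by linarith
  set f : (Fin k → ℝ) → ℝ := fun w => Real.exp (-q₁ * (∑ i, w i ^ 2) / 2) with hf_def
  have hf : Continuous f := by fun_prop
  have hperm : ∀ (e : Equiv.Perm (Fin k)) w, f (w ∘ e) = f w := fun e w => by
    simp only [hf_def, Function.comp_apply, Equiv.sum_comp e fun i => w i ^ 2]
  have hZ : ∫ w, f w ∂μ ≠ 0 :=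
    (integral_exp_pos (hsupp.integrable_of_continuous hf)).ne'
  have hE : ∀ i, ∫ w, f w * (w i * w i) ∂μ = Eq1 hk μ q₁ * ∫ w, f w ∂μ := by
    intro i
    have h := hexch.integral_mul_coord_mul_coord_perm hf hperm
      (Equiv.swap ⟨0, by omega⟩ i) ⟨0, by omega⟩ ⟨0, by omega⟩
    rw [Equiv.swap_apply_left] at h
    rw [Eq1, div_mul_cancel₀ _ hZ, h]
    simp only [hf_def, sq]
  have htilt : ∀ g : (Fin k → ℝ) → ℝ,
      ∫ w, Real.exp ((∑ l, y * w l) - (∑ l, ∑ l', w l *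
        (q₁ • (1 : Matrix (Fin k) (Fin k) ℝ) + q₂ • Matrix.of (fun _ _ => (1 : ℝ)) :
          Matrix (Fin k) (Fin k) ℝ) l l' *
          w l') / 2) * g w ∂μ = Real.exp (y - q₂ / 2) * ∫ w, f w * g w ∂μ := by
    intro g
    rw [← integral_const_mul]
    refine integral_congr_ae (hsupp.mono fun w hw => ?_)
    beta_reduce
    rw [symmetric_exponent_eq y q₁ q₂ hw.2, Real.exp_add, mul_assoc]
  have htilt_one := htilt fun _ => 1
  simp only [mul_one] at htilt_one
  ext i j
  simp only [tiltedSecondMomentOf, Matrix.of_apply, Matrix.sub_apply, Matrix.smul_apply,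
    smul_eq_mul, mul_one]
  rw [htilt fun w => w i * w j, htilt_one, mul_div_assoc,
    mul_div_mul_left _ _ (Real.exp_ne_zero _)]
  by_cases hij : i = j
  · subst hij
    rw [hE, Matrix.one_apply_eq]
    field_simp
    ring
  · have hrow := integral_mul_coord_sq_add hsupp hexch hf hperm hij
    have hone := card_mul_integral_mul_coord hsupp hexch hf hperm i
    rw [← hrow, hE] at hone
    have hoff : ∫ w, f w * (w i * w j) ∂μ =
        (1 - k * Eq1 hk μ q₁) / (k * (k - 1)) * ∫ w, f w ∂μ := by
      generalize ∫ w, f w * (w i * w j) ∂μ = m at hone ⊢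
      field_simp
      linear_combination hone
    rw [hoff, mul_div_cancel_right₀ _ hZ, Matrix.one_apply_ne hij]
    ring
end

section
/- Let k ≥ 2, β > 0, δ > 0, and let μ be a probability measure on ℝ^k supported on the probability simplex P₁(k) and invariant under all coordinate permutations. Define E(q) = (∫ w₁² exp(−q‖w‖₂²/2) dμ(w)) / (∫ exp(−q‖w‖₂²/2) dμ(w)) for q ≥ 0. Then: (a) k² E(q) ≥ 1 for every q ≥ 0; and (b) there exists q₁* ∈ [0, ∞) solving the fixed point equation q₁* = (kβδ/(k−1)) · ( E(β/(1+q₁*)) − 1/k² ). -/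
open MeasureTheory

theorem SimplexSupported.ae_abs_sq_le_one {k : ℕ} {μ : Measure (Fin k → ℝ)}
    (hsupp : SimplexSupported μ) (i : Fin k) : ∀ᵐ w ∂μ, |w i ^ 2| ≤ 1 := by
  filter_upwards [hsupp] with w hw
  have h1 : w i ≤ 1 := hw.2 ▸ Finset.single_le_sum (fun j _ => hw.1 j) (Finset.mem_univ i)
  rw [abs_of_nonneg (sq_nonneg _)]
  exact pow_le_one₀ (hw.1 i) h1

theorem abs_exp_neg_mul_sum_sq_mul_le_one {k : ℕ} {q a : ℝ} (hq : 0 ≤ q) (ha : |a| ≤ 1)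
    (w : Fin k → ℝ) : ‖Real.exp (-q * (∑ i, w i ^ 2) / 2) * a‖ ≤ 1 := by
  have hS : 0 ≤ q * ∑ i, w i ^ 2 := mul_nonneg hq (Finset.sum_nonneg fun i _ => sq_nonneg _)
  rw [norm_mul, Real.norm_eq_abs, Real.norm_eq_abs, Real.abs_exp]
  exact mul_le_one₀ (Real.exp_le_one_iff.2 (by linarith)) (abs_nonneg _) ha

theorem integrable_exp_neg_mul_sum_sq_mul {k : ℕ} {μ : Measure (Fin k → ℝ)} [IsFiniteMeasure μ]
    {F : (Fin k → ℝ) → ℝ} (hF : Continuous F) (hF1 : ∀ᵐ w ∂μ, |F w| ≤ 1) {q : ℝ} (hq : 0 ≤ q) :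
    Integrable (fun w => Real.exp (-q * (∑ i, w i ^ 2) / 2) * F w) μ := by
  refine Integrable.of_bound (Continuous.aestronglyMeasurable (by fun_prop)) 1 ?_
  filter_upwards [hF1] with w hw using abs_exp_neg_mul_sum_sq_mul_le_one hq hw w

theorem continuousOn_integral_exp_neg_mul_sum_sq_mul {k : ℕ} {μ : Measure (Fin k → ℝ)}
    [IsFiniteMeasure μ] {F : (Fin k → ℝ) → ℝ} (hF : Continuous F)
    (hF1 : ∀ᵐ w ∂μ, |F w| ≤ 1) :
    ContinuousOn (fun q : ℝ => ∫ w, Real.exp (-q * (∑ i, w i ^ 2) / 2) * F w ∂μ)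
      (Set.Ici 0) := by
  refine continuousOn_of_dominated (bound := fun _ => 1)
    (fun q _ => Continuous.aestronglyMeasurable (by fun_prop)) (fun q hq => ?_)
    (integrable_const _) (.of_forall fun w => by fun_prop)
  filter_upwards [hF1] with w hw using abs_exp_neg_mul_sum_sq_mul_le_one hq hw w

theorem integrable_exp_neg_mul_sum_sq {k : ℕ} (μ : Measure (Fin k → ℝ)) [IsFiniteMeasure μ]
    {q : ℝ} (hq : 0 ≤ q) : Integrable (fun w => Real.exp (-q * (∑ i, w i ^ 2) / 2)) μ := by
  simpa using integrable_exp_neg_mul_sum_sq_mul (μ := μ) (F := fun _ => 1) continuous_const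
    (by simp) hq

theorem integral_exp_neg_mul_sum_sq_pos {k : ℕ} (μ : Measure (Fin k → ℝ))
    [IsProbabilityMeasure μ] {q : ℝ} (hq : 0 ≤ q) :
    0 < ∫ w, Real.exp (-q * (∑ i, w i ^ 2) / 2) ∂μ :=
  integral_exp_pos (integrable_exp_neg_mul_sum_sq μ hq)

theorem Exchangeable.integral_exp_mul_sq_eq {k : ℕ} {μ : Measure (Fin k → ℝ)}
    (hexch : Exchangeable μ) (q : ℝ) (i j : Fin k) :
    ∫ w, Real.exp (-q * (∑ l, w l ^ 2) / 2) * w i ^ 2 ∂μ =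
      ∫ w, Real.exp (-q * (∑ l, w l ^ 2) / 2) * w j ^ 2 ∂μ := by
  conv_lhs => rw [← hexch (Equiv.swap i j)]
  rw [integral_map (Continuous.aemeasurable (by fun_prop))
    (Continuous.aestronglyMeasurable (by fun_prop))]
  refine integral_congr_ae (.of_forall fun w => ?_)
  have h := Equiv.sum_comp (Equiv.swap i j) fun l => w l ^ 2
  simp [h]

theorem one_le_sq_mul_Eq1 {k : ℕ} (hk : 2 ≤ k) {μ : Measure (Fin k → ℝ)}
    [IsProbabilityMeasure μ] (hsupp : SimplexSupported μ) (hexch : Exchangeable μ) {q : ℝ}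
    (hq : 0 ≤ q) : 1 ≤ (k : ℝ) ^ 2 * Eq1 hk μ q := by
  have hint (i : Fin k) : Integrable
      (fun w => Real.exp (-q * (∑ l, w l ^ 2) / 2) * w i ^ 2) μ :=
    integrable_exp_neg_mul_sum_sq_mul (by fun_prop) (hsupp.ae_abs_sq_le_one i) hq
  have hsum : ∫ w, ∑ i, Real.exp (-q * (∑ l, w l ^ 2) / 2) * w i ^ 2 ∂μ =
      k * ∫ w, Real.exp (-q * (∑ l, w l ^ 2) / 2) * w (⟨0, by omega⟩ : Fin k) ^ 2 ∂μ := by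
    rw [integral_finsetSum _ fun i _ => hint i,
      Finset.sum_congr rfl fun i _ => hexch.integral_exp_mul_sq_eq q i ⟨0, by omega⟩]
    simp
  have hle : ∫ w, Real.exp (-q * (∑ l, w l ^ 2) / 2) ∂μ ≤
      k * ∫ w, ∑ i, Real.exp (-q * (∑ l, w l ^ 2) / 2) * w i ^ 2 ∂μ := by
    rw [← integral_const_mul]
    refine integral_mono_ae (integrable_exp_neg_mul_sum_sq μ hq)
      ((integrable_finsetSum _ fun i _ => hint i).const_mul _) ?_
    filter_upwards [hsupp] with w hw
    have hcs : (1 : ℝ) ≤ k * ∑ i, w i ^ 2 := by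
      simpa [hw.2] using sq_sum_le_card_mul_sum_sq (s := Finset.univ) (f := w)
    rw [← Finset.mul_sum, mul_left_comm]
    exact le_mul_of_one_le_right (Real.exp_nonneg _) hcs
  rw [Eq1, ← mul_div_assoc, one_le_div (integral_exp_neg_mul_sum_sq_pos μ hq), sq, mul_assoc,
    ← hsum]
  exact hle

theorem Eq1_le_one {k : ℕ} (hk : 2 ≤ k) {μ : Measure (Fin k → ℝ)} [IsProbabilityMeasure μ]
    (hsupp : SimplexSupported μ) {q : ℝ} (hq : 0 ≤ q) : Eq1 hk μ q ≤ 1 := by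
  rw [Eq1, div_le_one (integral_exp_neg_mul_sum_sq_pos μ hq)]
  refine integral_mono_ae (integrable_exp_neg_mul_sum_sq_mul (by fun_prop)
    (hsupp.ae_abs_sq_le_one _) hq) (integrable_exp_neg_mul_sum_sq μ hq) ?_
  filter_upwards [hsupp.ae_abs_sq_le_one ⟨0, by omega⟩] with w hw
  exact mul_le_of_le_one_right (Real.exp_nonneg _) ((le_abs_self _).trans hw)

theorem continuousOn_Eq1 {k : ℕ} (hk : 2 ≤ k) {μ : Measure (Fin k → ℝ)}
    [IsProbabilityMeasure μ] (hsupp : SimplexSupported μ) :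
    ContinuousOn (Eq1 hk μ) (Set.Ici 0) := by
  refine ContinuousOn.div (continuousOn_integral_exp_neg_mul_sum_sq_mul (by fun_prop)
    (hsupp.ae_abs_sq_le_one _)) ?_ fun q hq => (integral_exp_neg_mul_sum_sq_pos μ hq).ne'
  simpa using continuousOn_integral_exp_neg_mul_sum_sq_mul (μ := μ) (F := fun _ => 1)
    continuous_const (by simp)

/-- For an exchangeable prior on the simplex: (a) `k² E(q) ≥ 1` for all `q ≥ 0`, and
(b) the fixed point equation `q₁* = (kβδ/(k-1)) (E(β/(1+q₁*)) - 1/k²)` has a solution in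
`[0, ∞)`. -/
theorem Eq1_bound_and_fixed_point
    (k : ℕ) (hk : 2 ≤ k) (β δ : ℝ) (hβ : 0 < β) (hδ : 0 < δ)
    (μ : Measure (Fin k → ℝ)) [IsProbabilityMeasure μ]
    (hsupp : SimplexSupported μ) (hexch : Exchangeable μ) :
    (∀ q : ℝ, 0 ≤ q → 1 ≤ (k : ℝ) ^ 2 * Eq1 hk μ q) ∧
    (∃ q₁ : ℝ, 0 ≤ q₁ ∧
      q₁ = (k * β * δ / (k - 1)) * (Eq1 hk μ (β / (1 + q₁)) - 1 / (k : ℝ) ^ 2)) := by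
  refine ⟨fun q hq => one_le_sq_mul_Eq1 hk hsupp hexch hq, ?_⟩
  have hk2 : (2 : ℝ) ≤ k := by exact_mod_cast hk
  set C : ℝ := k * β * δ / (k - 1)
  have hC0 : 0 ≤ C := div_nonneg (by positivity) (by linarith)
  have harg {x : ℝ} (hx : 0 ≤ x) : 0 ≤ β / (1 + x) := by positivity
  have hcont : ContinuousOn
      (fun x => C * (Eq1 hk μ (β / (1 + x)) - 1 / (k : ℝ) ^ 2)) (Set.Icc 0 C) := by
    refine continuousOn_const.mul (ContinuousOn.sub ?_ continuousOn_const)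
    refine (continuousOn_Eq1 hk hsupp).comp (t := Set.Ici 0) ?_ fun x hx => harg hx.1
    exact continuousOn_const.div (by fun_prop) fun x hx => by linarith [hx.1]
  have hmaps : Set.MapsTo
      (fun x => C * (Eq1 hk μ (β / (1 + x)) - 1 / (k : ℝ) ^ 2)) (Set.Icc 0 C)
      (Set.Icc 0 C) := by
    intro x hx
    have hlow : 1 / (k : ℝ) ^ 2 ≤ Eq1 hk μ (β / (1 + x)) := by
      rw [div_le_iff₀' (by positivity)]
      exact one_le_sq_mul_Eq1 hk hsupp hexch (harg hx.1)
    have hup := Eq1_le_one hk hsupp (harg hx.1)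
    have hpos : 0 ≤ 1 / (k : ℝ) ^ 2 := by positivity
    exact ⟨mul_nonneg hC0 (by linarith), mul_le_of_le_one_right hC0 (by linarith)⟩
  obtain ⟨x, hx, hfix⟩ := exists_mem_Icc_isFixedPt_of_mapsTo hcont hC0 hmaps
  exact ⟨x, hx.1, hfix.symm⟩
end

section
/- Let f : ℝⁿ × ℝ^d → ℝ be twice continuously differentiable in a neighborhood of a point (x*, y*) at which ∇f(x*, y*) = 0, and write the Hessian of f at (x*, y*) in blocks H = [[H_xx, H_xy], [H_xyᵀ, H_yy]] with H_xx ∈ ℝ^{n×n}, H_yy ∈ ℝ^{d×d}. Assume H_yy is positive definite. Then there exist a neighborhood U of x* and a continuously differentiable map g : U → ℝ^d with g(x*) = y* and ∇_y f(x, g(x)) = 0 for all x ∈ U, such that the function f₁(x) = f(x, g(x)) is twice differentiable at x* with Hessian ∇²f₁(x*) = H_xx − H_xy H_yy⁻¹ H_xyᵀ. In particular, H is positive definite if and only if ∇²f₁(x*) is positive definite. -/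
open Matrix

open Filter Topology

/-- A block matrix with positive definite lower right block is positive definite iff its
Schur complement is. -/
theorem Matrix.PosDef.fromBlocks₂₂_iff {m n : Type*} [Fintype m] [Fintype n] [DecidableEq n]
    (A : Matrix m m ℝ) (B : Matrix m n ℝ) {D : Matrix n n ℝ} (hD : D.PosDef) :
    (fromBlocks A B Bᵀ D).PosDef ↔ (A - B * D⁻¹ * Bᵀ).PosDef := by
  have : Invertible D := hD.isUnit.invertible
  rw [← conjTranspose_eq_transpose_of_trivial, posDef_iff_dotProduct_mulVec,
    posDef_iff_dotProduct_mulVec, IsHermitian.fromBlocks₂₂ A B hD.1]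
  refine and_congr_right fun _ => ⟨fun h x hx => ?_, fun h z hz => ?_⟩
  · have hne : Sum.elim x (-((D⁻¹ * Bᴴ) *ᵥ x)) ≠ 0 := fun h0 =>
      hx (funext fun i => congrFun h0 (Sum.inl i))
    have := h hne
    rwa [dotProduct_mulVec, schur_complement_eq₂₂ A B _ _ hD.1, add_neg_cancel,
      dotProduct_zero, zero_add, ← dotProduct_mulVec] at this
  · obtain ⟨x, y, rfl⟩ : ∃ x y, z = Sum.elim x y :=
      ⟨_, _, (Sum.elim_comp_inl_inr z).symm⟩
    rw [dotProduct_mulVec, schur_complement_eq₂₂ A B _ _ hD.1, ← dotProduct_mulVec,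
      ← dotProduct_mulVec]
    by_cases hx : x = 0
    · subst hx
      have hy : y ≠ 0 := by
        rintro rfl
        exact hz (Sum.elim_zero_zero)
      simpa using hD.dotProduct_mulVec_pos hy
    · exact add_pos_of_nonneg_of_pos (hD.posSemidef.dotProduct_mulVec_nonneg _) (h hx)

/-- Partial critical points of a `C²` function with invertible second partial derivative are
locally the graph of a `C¹` map `g`, and `x ↦ f (x, g x)` is twice differentiable at the base
point. -/
theorem ContDiffAt.exists_partial_critical_map {E F : Type*}
    [NormedAddCommGroup E] [NormedSpace ℝ E] [CompleteSpace E]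
    [NormedAddCommGroup F] [NormedSpace ℝ F] [CompleteSpace F]
    {f : E × F → ℝ} {u : E × F} (hf : ContDiffAt ℝ 2 f u)
    (hcrit : fderiv ℝ f u ∘L .inr ℝ E F = 0)
    (hinv : ((ContinuousLinearMap.precomp ℝ (.inr ℝ E F)) ∘L fderiv ℝ (fderiv ℝ f) u ∘L
      .inr ℝ E F).IsInvertible) :
    ∃ U ∈ 𝓝 u.1, ∃ (g : E → F) (g' : E →L[ℝ] F), ContDiffOn ℝ 1 g U ∧ g u.1 = u.2 ∧
      (∀ x ∈ U, fderiv ℝ (fun y => f (x, y)) (g x) = 0) ∧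
      (∀ w v, fderiv ℝ (fderiv ℝ f) u (w, g' w) (0, v) = 0) ∧
      HasFDerivAt (fderiv ℝ fun x => f (x, g x))
        ((ContinuousLinearMap.precomp ℝ (.inl ℝ E F)) ∘L fderiv ℝ (fderiv ℝ f) u ∘L
          (ContinuousLinearMap.id ℝ E).prod g') u.1 := by
  have hD : ContDiffAt ℝ 1 (fderiv ℝ f) u := hf.fderiv_right (by norm_num)
  have hDu : HasFDerivAt (fderiv ℝ f) (fderiv ℝ (fderiv ℝ f) u) u :=
    (hD.differentiableAt one_ne_zero).hasFDerivAt
  let R : (E × F →L[ℝ] ℝ) →L[ℝ] (F →L[ℝ] ℝ) := ContinuousLinearMap.precomp ℝ (.inr ℝ E F)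
  have hφ : ContDiffAt ℝ 1 (fun q => R (fderiv ℝ f q)) u := R.contDiff.contDiffAt.comp u hD
  have hφ' : HasFDerivAt (fun q => R (fderiv ℝ f q)) (R ∘L fderiv ℝ (fderiv ℝ f) u) u :=
    R.hasFDerivAt.comp u hDu
  have hinv' : (fderiv ℝ (fun q => R (fderiv ℝ f q)) u ∘L .inr ℝ E F).IsInvertible := by
    rw [hφ'.fderiv]; exact hinv
  let g := hφ.implicitFunction one_ne_zero hinv'
  have hgu : g u.1 = u.2 := hφ.implicitFunction_apply_self one_ne_zero hinv'
  have hg1 : ContDiffAt ℝ 1 g u.1 := hφ.contDiffAt_implicitFunction one_ne_zero hinv'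
  have hzero : ∀ᶠ x in 𝓝 u.1, R (fderiv ℝ f (x, g x)) = 0 := by
    filter_upwards [hφ.eventually_apply_implicitFunction one_ne_zero hinv'] with x hx
    exact hx.trans hcrit
  have hg' : HasFDerivAt g (fderiv ℝ g u.1) u.1 :=
    (hg1.differentiableAt one_ne_zero).hasFDerivAt
  have hgraph : HasFDerivAt (fun x => (x, g x))
      ((ContinuousLinearMap.id ℝ E).prod (fderiv ℝ g u.1)) u.1 :=
    (hasFDerivAt_id u.1).prodMk hg'
  have hu : (u.1, g u.1) = u := by rw [hgu]
  have hDgraph : HasFDerivAt (fun x => fderiv ℝ f (x, g x))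
      (fderiv ℝ (fderiv ℝ f) u ∘L (ContinuousLinearMap.id ℝ E).prod (fderiv ℝ g u.1)) u.1 := by
    refine HasFDerivAt.comp u.1 (g := fderiv ℝ f) ?_ hgraph
    rwa [hu]
  have hfdiff : ∀ᶠ x in 𝓝 u.1, DifferentiableAt ℝ f (x, g x) := by
    have h : ∀ᶠ q in 𝓝 u, DifferentiableAt ℝ f q :=
      (hf.eventually (by simp)).mono fun q hq => hq.differentiableAt two_ne_zero
    exact hgraph.continuousAt.eventually (hu.symm ▸ h)
  have hgdiff : ∀ᶠ x in 𝓝 u.1, DifferentiableAt ℝ g x :=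
    (hg1.eventually (by simp)).mono fun q hq => hq.differentiableAt one_ne_zero
  obtain ⟨V, hV, hgV⟩ := hg1.contDiffOn (m := 1) le_rfl (by simp)
  refine ⟨_, inter_mem hV (hzero.and hfdiff), g, fderiv ℝ g u.1,
    hgV.mono Set.inter_subset_left, hgu, ?_, ?_, ?_⟩
  · rintro x ⟨-, hx0, hxf⟩
    exact (hxf.hasFDerivAt.comp (g x) (hasFDerivAt_prodMk_right x (g x))).fderiv.trans hx0
  · have h0 := (R.hasFDerivAt.comp u.1 hDgraph).unique
      ((hasFDerivAt_const (0 : F →L[ℝ] ℝ) u.1).congr_of_eventuallyEq hzero)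
    exact fun w v => DFunLike.congr_fun (DFunLike.congr_fun h0 w) v
  · refine ((ContinuousLinearMap.precomp ℝ (.inl ℝ E F)).hasFDerivAt.comp u.1
      hDgraph).congr_of_eventuallyEq ?_
    filter_upwards [hzero, hfdiff, hgdiff] with x hx0 hxf hxg
    have h1 : HasFDerivAt (fun x => f (x, g x))
        (fderiv ℝ f (x, g x) ∘L (ContinuousLinearMap.id ℝ E).prod (fderiv ℝ g x)) x :=
      hxf.hasFDerivAt.comp x ((hasFDerivAt_id x).prodMk hxg.hasFDerivAt)
    rw [h1.fderiv]
    ext v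
    have h2 : fderiv ℝ f (x, g x) (0, fderiv ℝ g x v) = 0 := DFunLike.congr_fun hx0 _
    have h3 : ((v, fderiv ℝ g x v) : E × F) = (v, 0) + (0, fderiv ℝ g x v) := by simp
    change fderiv ℝ f (x, g x) (v, fderiv ℝ g x v) = fderiv ℝ f (x, g x) (v, 0)
    rw [h3, map_add, h2, add_zero]

/-- Partial minimization at a critical point: if `f` is `C²` near a critical point `(x*, y*)`
with Hessian blocks `H_xx, H_xy, H_yy` and `H_yy` positive definite, then locally there is a
`C¹` map `g` with `g x* = y*`, `∇_y f(x, g(x)) = 0`, and the Hessian of `f₁(x) = f(x, g(x))`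
at `x*` is the Schur complement `H_xx - H_xy H_yy⁻¹ H_xyᵀ`; moreover the full Hessian is
positive definite iff this Schur complement is. -/
theorem partial_minimization_schur_hessian
    (n d : ℕ) (f : (Fin n → ℝ) × (Fin d → ℝ) → ℝ)
    (xs : Fin n → ℝ) (ys : Fin d → ℝ)
    (hf : ContDiffAt ℝ 2 f (xs, ys))
    (hcrit : fderiv ℝ f (xs, ys) = 0)
    (Hxx : Matrix (Fin n) (Fin n) ℝ)
    (Hxy : Matrix (Fin n) (Fin d) ℝ)
    (Hyy : Matrix (Fin d) (Fin d) ℝ)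
    (hHxx : ∀ i j, Hxx i j =
      fderiv ℝ (fun q => fderiv ℝ f q (Pi.single j 1, 0)) (xs, ys) (Pi.single i 1, 0))
    (hHxy : ∀ i j, Hxy i j =
      fderiv ℝ (fun q => fderiv ℝ f q (0, Pi.single j 1)) (xs, ys) (Pi.single i 1, 0))
    (hHyy : ∀ i j, Hyy i j =
      fderiv ℝ (fun q => fderiv ℝ f q (0, Pi.single j 1)) (xs, ys) (0, Pi.single i 1))
    (hHyypd : Hyy.PosDef) :
    ∃ U ∈ nhds xs, ∃ g : (Fin n → ℝ) → (Fin d → ℝ),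
      ContDiffOn ℝ 1 g U ∧ g xs = ys ∧
      (∀ x ∈ U, fderiv ℝ (fun y => f (x, y)) (g x) = 0) ∧
      (∀ j : Fin n, DifferentiableAt ℝ
        (fun x => fderiv ℝ (fun x' => f (x', g x')) x (Pi.single j 1)) xs) ∧
      (Matrix.of fun i j : Fin n =>
          fderiv ℝ (fun x => fderiv ℝ (fun x' => f (x', g x')) x (Pi.single j 1)) xs
            (Pi.single i 1))
        = Hxx - Hxy * Hyy⁻¹ * Hxyᵀ ∧
      ((Matrix.fromBlocks Hxx Hxy Hxyᵀ Hyy).PosDef ↔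
        (Hxx - Hxy * Hyy⁻¹ * Hxyᵀ).PosDef) := by
  have hD : DifferentiableAt ℝ (fderiv ℝ f) (xs, ys) :=
    (hf.fderiv_right (m := 1) (by norm_num)).differentiableAt one_ne_zero
  have hentry (v w) : fderiv ℝ (fun q => fderiv ℝ f q v) (xs, ys) w =
      fderiv ℝ (fderiv ℝ f) (xs, ys) w v := by
    rw [fderiv_clm_apply hD (differentiableAt_const v)]
    simp
  have hsymm (v w) : fderiv ℝ (fderiv ℝ f) (xs, ys) v w = fderiv ℝ (fderiv ℝ f) (xs, ys) w v :=
    (hf.isSymmSndFDerivAt (by simp)).eq v w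
  simp only [hentry] at hHxx hHxy hHyy
  set L := fderiv ℝ (fderiv ℝ f) (xs, ys) with hL
  have hexpand (y : Fin d → ℝ) (v) : L (0, y) v = ∑ k, y k * L (0, Pi.single k 1) v := by
    have hy : ((0, y) : (Fin n → ℝ) × (Fin d → ℝ)) = ∑ k, y k • (0, Pi.single k 1) := by
      ext i
      · simp [Prod.fst_sum]
      · simp [Prod.snd_sum, Finset.sum_apply, Pi.single_apply]
    rw [hy, map_sum, _root_.sum_apply]
    simp only [map_smul, _root_.smul_apply, smul_eq_mul]
  have hexpand' (y : Fin d → ℝ) (j) : L (0, y) (0, Pi.single j 1) = (y ᵥ* Hyy) j := by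
    rw [hexpand]
    simp [vecMul, dotProduct, hHyy]
  have hinv : ((ContinuousLinearMap.precomp ℝ (.inr ℝ (Fin n → ℝ) (Fin d → ℝ))) ∘L L ∘L
      .inr ℝ (Fin n → ℝ) (Fin d → ℝ)).IsInvertible := by
    set T := (ContinuousLinearMap.precomp ℝ (.inr ℝ (Fin n → ℝ) (Fin d → ℝ))) ∘L L ∘L
      .inr ℝ (Fin n → ℝ) (Fin d → ℝ)
    have hinj : Function.Injective (T : (Fin d → ℝ) →ₗ[ℝ] ((Fin d → ℝ) →L[ℝ] ℝ)) := by
      refine (injective_iff_map_eq_zero _).2 fun y hy => ?_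
      refine vecMul_injective_of_isUnit hHyypd.isUnit ?_
      ext j
      change (y ᵥ* Hyy) j = (0 ᵥ* Hyy) j
      rw [zero_vecMul, ← hexpand']
      exact DFunLike.congr_fun hy _
    have hrank : Module.finrank ℝ (Fin d → ℝ) = Module.finrank ℝ ((Fin d → ℝ) →L[ℝ] ℝ) := by
      rw [← (LinearMap.toContinuousLinearMap (𝕜 := ℝ) (E := Fin d → ℝ) (F' := ℝ)).finrank_eq]
      simp
    exact ⟨(LinearEquiv.ofInjectiveOfFinrankEq _ hinj hrank).toContinuousLinearEquiv, by
      ext; rfl⟩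
  obtain ⟨U, hU, g, g', hgU, hgx, hcritU, hg', hhess⟩ :=
    hf.exists_partial_critical_map (by rw [hcrit]; rfl) hinv
  have hrow (v : Fin n → ℝ) : HasFDerivAt (fun x => fderiv ℝ (fun x' => f (x', g x')) x v) _ xs :=
    (ContinuousLinearMap.apply ℝ ℝ v).hasFDerivAt.comp xs hhess
  have hsplit (w : Fin n → ℝ) (v) : L (w, g' w) v = L (w, 0) v + L (0, g' w) v := by
    have h : ((w, g' w) : (Fin n → ℝ) × (Fin d → ℝ)) = (w, 0) + (0, g' w) := by simp
    rw [h, map_add, _root_.add_apply]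
  let G : Matrix (Fin n) (Fin d) ℝ := .of fun i => g' (Pi.single i 1)
  have hG : Hxy + G * Hyy = 0 := by
    ext i j
    have h := hg' (Pi.single i 1) (Pi.single j 1)
    rw [← hL, hsplit, hexpand', ← hHxy] at h
    exact h
  have hG' : G = -(Hxy * Hyy⁻¹) := by
    have hdet := (isUnit_iff_isUnit_det _).1 hHyypd.isUnit
    rw [← mul_nonsing_inv_cancel_right Hyy G hdet, eq_neg_of_add_eq_zero_right hG, Matrix.neg_mul]
  refine ⟨U, hU, g, hgU, hgx, hcritU, fun j => (hrow _).differentiableAt, ?_,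
    hHyypd.fromBlocks₂₂_iff Hxx Hxy⟩
  have hval : Hxx - Hxy * Hyy⁻¹ * Hxyᵀ = Hxx + G * Hxyᵀ := by
    rw [hG', Matrix.neg_mul, sub_eq_add_neg]
  rw [hval]
  ext i j
  rw [of_apply, (hrow _).fderiv]
  change L (Pi.single i 1, g' (Pi.single i 1)) (Pi.single j 1, 0) = _
  rw [hsplit, hexpand, Matrix.add_apply, hHxx, mul_apply]
  simp only [hsymm (0, _), ← hHxy, transpose_apply]
  rfl
end
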